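/- arXiv:2002.11428 — 7 statements merged into one kernel-verified Lean document; each statement's English description precedes it below -/
import Mathlib

section
/- For all ℓ', ℓ'' ∈ ℝ_{≥0}^V, the normalization function satisfies ‖π(ℓ'') − π(ℓ')‖_∞ ≤ ‖ℓ'' − ℓ'‖_∞, i.e., π is 1-Lipschitz with respect to the supremum norm. -/
noncomputable section

open Finset

variable {V : Type*}

/-- The function `ϱ^a` prescribing the behavior of labels along an arc. -/
def arcRho [DecidableEq V] (Astar : Finset (V × V)) (nu : V × V → ℝ)
    (a : V × V) (lv xa : ℝ) : ℝ :=
  if a ∈ Astar then xa / nu a else max lv (xa / nu a)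

/-- Total flow on arcs of `Aset` leaving `v`. -/
def outSum [DecidableEq V] (Aset : Finset (V × V)) (x : V × V → ℝ) (v : V) : ℝ :=
  ∑ a ∈ Aset.filter (fun a => a.1 = v), x a

/-- Total flow on arcs of `Aset` entering `v`. -/
def inSum [DecidableEq V] (Aset : Finset (V × V)) (x : V × V → ℝ) (v : V) : ℝ :=
  ∑ a ∈ Aset.filter (fun a => a.2 = v), x a

/-- `(V, Aset, Astar)` is a shortest path graph with resetting with source `s`:
`Astar ⊆ Aset`, `(V, Aset)` is acyclic, and every vertex is reachable from `s`. -/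
def IsSPGR [DecidableEq V] (Aset Astar : Finset (V × V)) (s : V) : Prop :=
  Astar ⊆ Aset ∧
  (∀ v : V, ¬ Relation.TransGen (fun u w => (u, w) ∈ Aset) v v) ∧
  (∀ v : V, Relation.ReflTransGen (fun u w => (u, w) ∈ Aset) s v)

/-- `x` is a static `s`-`t` flow of value `val` on the arcs `Aset`,
with conservation required at the vertices of `Vset`. -/
def IsFlowOn [DecidableEq V] (Vset : Finset V) (Aset : Finset (V × V)) (s t : V)
    (x : V × V → ℝ) (val : ℝ) : Prop :=
  (∀ a ∈ Aset, 0 ≤ x a) ∧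
  (∀ v ∈ Vset, v ≠ s → v ≠ t → outSum Aset x v = inSum Aset x v) ∧
  outSum Aset x s - inSum Aset x s = val

/-- `x` is a normalized thin `s`-`t` flow with resetting of value `val`
with corresponding labels `l`. -/
def IsNTFOn [DecidableEq V] (Vset : Finset V) (Aset Astar : Finset (V × V)) (nu : V × V → ℝ)
    (s t : V) (x : V × V → ℝ) (val : ℝ) (l : V → ℝ) : Prop :=
  IsFlowOn Vset Aset s t x val ∧
  (∀ v ∈ Vset, 0 ≤ l v) ∧
  (∀ w ∈ Vset, w ≠ s →
    (∀ a ∈ Aset, a.2 = w → l w ≤ arcRho Astar nu a (l a.1) (x a)) ∧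
    (∃ a ∈ Aset, a.2 = w ∧ l w = arcRho Astar nu a (l a.1) (x a))) ∧
  (∀ a ∈ Aset, 0 < x a → l a.2 = arcRho Astar nu a (l a.1) (x a))

/-- Normalized thin `s`-`t` flow with resetting on the whole vertex type. -/
def IsNTF [DecidableEq V] [Fintype V] (Aset Astar : Finset (V × V)) (nu : V × V → ℝ)
    (s t : V) (x : V × V → ℝ) (val : ℝ) (l : V → ℝ) : Prop :=
  IsNTFOn Finset.univ Aset Astar nu s t x val l

/-- The arc relation of a shortest path graph with resetting on a finite vertex set is
well-founded. -/
theorem IsSPGR.wellFounded [DecidableEq V] [Finite V] {Aset Astar : Finset (V × V)} {s : V}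
    (hG : IsSPGR Aset Astar s) : WellFounded (fun u w : V => (u, w) ∈ Aset) := by
  have : Std.Irrefl (Relation.TransGen fun u w : V => (u, w) ∈ Aset) := ⟨hG.2.1⟩
  exact Subrelation.wf (fun h => Relation.TransGen.single h)
    (Finite.wellFounded_of_trans_of_irrefl (Relation.TransGen fun u w : V => (u, w) ∈ Aset))

/-- Every vertex other than the source has an entering arc. -/
theorem IsSPGR.exists_arc_to [DecidableEq V] {Aset Astar : Finset (V × V)} {s w : V}
    (hG : IsSPGR Aset Astar s) (hw : w ≠ s) : ∃ u, (u, w) ∈ Aset := by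
  rcases Relation.ReflTransGen.cases_tail (hG.2.2 w) with h | ⟨u, -, hu⟩
  · exact absurd h hw
  · exact ⟨u, hu⟩

/-- The normalization function preserves upper bounds on label differences. -/
theorem normalization_le_add [DecidableEq V] [Finite V]
    {Aset Astar : Finset (V × V)} {s : V} (hG : IsSPGR Aset Astar s)
    {pi : (V → ℝ) → V → ℝ}
    (hpi1 : ∀ l : V → ℝ, ∀ w : V, w ≠ s → (∀ a ∈ Astar, a.2 ≠ w) →
      pi l w = max (l w) (sInf {r : ℝ | ∃ a ∈ Aset, a.2 = w ∧ r = pi l a.1}))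
    (hpi2 : ∀ l : V → ℝ, ∀ w : V, (w = s ∨ ∃ a ∈ Astar, a.2 = w) → pi l w = l w)
    {l l' : V → ℝ} {c : ℝ} (h : ∀ v, l' v ≤ l v + c) (w : V) :
    pi l' w ≤ pi l w + c := by
  induction w using hG.wellFounded.induction with
  | _ w ih =>
    by_cases hw : w = s ∨ ∃ a ∈ Astar, a.2 = w
    · rw [hpi2 l' w hw, hpi2 l w hw]
      exact h w
    · push Not at hw
      rw [hpi1 l' w hw.1 hw.2, hpi1 l w hw.1 hw.2, ← max_add_add_right]
      refine max_le_max (h w) ?_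
      rw [← sub_le_iff_le_add]
      obtain ⟨u, hu⟩ := hG.exists_arc_to hw.1
      refine le_csInf ⟨_, (u, w), hu, rfl, rfl⟩ ?_
      rintro _ ⟨⟨v, _⟩, hv, rfl, rfl⟩
      rw [sub_le_iff_le_add]
      refine le_trans (csInf_le ?_ ⟨(v, _), hv, rfl, rfl⟩) (ih v hv)
      refine ((Aset.finite_toSet.image fun a => pi l' a.1).subset ?_).bddBelow
      rintro _ ⟨a, ha, -, rfl⟩
      exact ⟨a, ha, rfl⟩

/-- The normalization function is 1-Lipschitz with respect to
the supremum norm on `ℝ≥0^V`. -/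
theorem statement2 [DecidableEq V] [Fintype V]
    (Aset Astar : Finset (V × V)) (s : V)
    (hG : IsSPGR Aset Astar s)
    (pi : (V → ℝ) → V → ℝ)
    (hpi1 : ∀ l : V → ℝ, ∀ w : V, w ≠ s → (∀ a ∈ Astar, a.2 ≠ w) →
      pi l w = max (l w) (sInf {r : ℝ | ∃ a ∈ Aset, a.2 = w ∧ r = pi l a.1}))
    (hpi2 : ∀ l : V → ℝ, ∀ w : V, (w = s ∨ ∃ a ∈ Astar, a.2 = w) → pi l w = l w)
    :
    ∀ l l' : V → ℝ, (∀ v, 0 ≤ l v) → (∀ v, 0 ≤ l' v) →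
      ‖pi l' - pi l‖ ≤ ‖l' - l‖ := by
  intro l l' _ _
  have hle (v : V) : |l' v - l v| ≤ ‖l' - l‖ := norm_le_pi_norm (l' - l) v
  refine (pi_norm_le_iff_of_nonneg (norm_nonneg _)).2 fun w => ?_
  rw [Pi.sub_apply, Real.norm_eq_abs, abs_sub_le_iff, sub_le_iff_le_add', sub_le_iff_le_add']
  exact ⟨normalization_le_add hG hpi1 hpi2
      (fun v => sub_le_iff_le_add'.1 (abs_sub_le_iff.1 (hle v)).1) w,
    normalization_le_add hG hpi1 hpi2
      (fun v => sub_le_iff_le_add'.1 (abs_sub_le_iff.1 (hle v)).2) w⟩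
end
end

section
/- Let G' = (V, A', A*) be a shortest path graph with resetting with capacities ν, and let M be the associated matrix. Then all principal minors of M are non-negative: for every subset S of the index set V ⊔ A' ⊔ (A'∖A*), det(M_{S,S}) ≥ 0. -/
noncomputable section

open Finset

variable {V : Type*}

/-- Index set `V ⊔ A' ⊔ (A' \ A*)` of the linear complementarity problem. -/
abbrev LCPIdx [DecidableEq V] (Aset Astar : Finset (V × V)) :=
  V ⊕ ({a : V × V // a ∈ Aset} ⊕ {a : V × V // a ∈ Aset \ Astar})

/-- The matrix `M` of the linear complementarity problem. -/
def lcpM [DecidableEq V] (Aset Astar : Finset (V × V)) (nu : V × V → ℝ) (s : V) :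
    Matrix (LCPIdx Aset Astar) (LCPIdx Aset Astar) ℝ :=
  fun i j =>
    match i, j with
    | Sum.inl v, Sum.inl u => if v = s ∧ u = s then 1 else 0
    | Sum.inl v, Sum.inr (Sum.inl b) =>
        if v = s then 0
        else (if b.val.2 = v then (1 : ℝ) else 0) - (if b.val.1 = v then (1 : ℝ) else 0)
    | Sum.inl _, Sum.inr (Sum.inr _) => 0
    | Sum.inr (Sum.inl a), Sum.inl u => -(if a.val.2 = u then (1 : ℝ) else 0)
    | Sum.inr (Sum.inl a), Sum.inr (Sum.inl b) => if a.val = b.val then (nu a.val)⁻¹ else 0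
    | Sum.inr (Sum.inl a), Sum.inr (Sum.inr b) => if a.val = b.val then 1 else 0
    | Sum.inr (Sum.inr a), Sum.inl u => -(if a.val.1 = u then (1 : ℝ) else 0)
    | Sum.inr (Sum.inr a), Sum.inr (Sum.inl b) => if a.val = b.val then (nu a.val)⁻¹ else 0
    | Sum.inr (Sum.inr a), Sum.inr (Sum.inr b) => if a = b then 1 else 0

/-- The vector `z = (ℓ', x', y')`. -/
def lcpZ [DecidableEq V] (Aset Astar : Finset (V × V))
    (l : V → ℝ) (x y : V × V → ℝ) : LCPIdx Aset Astar → ℝ :=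
  Sum.elim l (Sum.elim (fun a => x a.val) (fun a => y a.val))

/-- The right hand side `ℓ₀'·1_s + ν₀'·1_t`. -/
def lcpQ [DecidableEq V] (Aset Astar : Finset (V × V)) (s t : V) (l0 nu0 : ℝ) :
    LCPIdx Aset Astar → ℝ :=
  fun i => (if i = Sum.inl s then l0 else 0) + (if i = Sum.inl t then nu0 else 0)

/-- `z` solves the LCP: `z ≥ 0`, `M z − ℓ₀'·1_s − ν₀'·1_t ≥ 0`,
`zᵀ (M z − ℓ₀'·1_s − ν₀'·1_t) = 0`. -/
def IsLCPSol [DecidableEq V] [Fintype V] (Aset Astar : Finset (V × V)) (nu : V × V → ℝ)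
    (s t : V) (l0 nu0 : ℝ) (z : LCPIdx Aset Astar → ℝ) : Prop :=
  (∀ i, 0 ≤ z i) ∧
  (∀ i, 0 ≤ (lcpM Aset Astar nu s).mulVec z i - lcpQ Aset Astar s t l0 nu0 i) ∧
  ∑ i, z i * ((lcpM Aset Astar nu s).mulVec z i - lcpQ Aset Astar s t l0 nu0 i) = 0

/-- The normalization constraints: `ℓ'_w ≥ min_{v : (v,w) ∈ A'} ℓ'_v` for every
`w ≠ s` not entered by any resetting arc. -/
def NormConstraint [DecidableEq V] (Aset Astar : Finset (V × V)) (s : V) (l : V → ℝ) : Prop :=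
  ∀ w : V, w ≠ s → (∀ a ∈ Astar, a.2 ≠ w) → ∃ a ∈ Aset, a.2 = w ∧ l a.1 ≤ l w

/-- A real matrix `M` with `M + t • 1` injective for every `t > 0` has non-negative determinant. -/
theorem Matrix.det_nonneg_of_add_smul_injective {n : Type*} [Fintype n] [DecidableEq n]
    (M : Matrix n n ℝ)
    (h : ∀ t : ℝ, 0 < t → ∀ z : n → ℝ, (∀ i, M.mulVec z i + t * z i = 0) → z = 0) :
    0 ≤ M.det := by
  by_contra! hneg
  have hcont : Continuous fun r : ℝ => ((1 - r) • (1 : Matrix n n ℝ) + r • M).det := by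
    fun_prop
  obtain ⟨r, ⟨hr0, hr1⟩, hr⟩ := intermediate_value_Icc' zero_le_one hcont.continuousOn
    (show (0 : ℝ) ∈ _ by simp [hneg.le])
  have hr0' : 0 < r := by
    rcases hr0.eq_or_lt with rfl | h0
    · simp at hr
    · exact h0
  have hr1' : r < 1 := by
    rcases hr1.eq_or_lt with rfl | h1
    · simp [hneg.ne] at hr
    · exact h1
  obtain ⟨z, hz, hMz⟩ := Matrix.exists_mulVec_eq_zero_iff.mpr hr
  refine hz (h ((1 - r) / r) (div_pos (sub_pos.mpr hr1') hr0') z fun i => ?_)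
  have hi := congrFun hMz i
  simp only [Matrix.add_mulVec, Matrix.smul_mulVec, Matrix.one_mulVec, Pi.add_apply,
    Pi.smul_apply, smul_eq_mul, Pi.zero_apply] at hi
  field_simp
  linarith

/-- A criterion for all principal minors to be non-negative. -/
theorem Matrix.det_principal_submatrix_nonneg {n : Type*} [Fintype n] [DecidableEq n]
    (M : Matrix n n ℝ)
    (h : ∀ t : ℝ, 0 < t → ∀ z : n → ℝ, (∀ i, z i = 0 ∨ M.mulVec z i + t * z i = 0) → z = 0)
    (S : Finset n) :
    0 ≤ (M.submatrix (fun i : {i // i ∈ S} => i.val) (fun j : {j // j ∈ S} => j.val)).det := by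
  refine Matrix.det_nonneg_of_add_smul_injective _ fun t ht z hz => ?_
  set w : n → ℝ := fun i => if hi : i ∈ S then z ⟨i, hi⟩ else 0 with hw
  have hmul : ∀ i, M.mulVec w i = ∑ j : {j // j ∈ S}, M i j * z j := by
    intro i
    rw [Matrix.mulVec, dotProduct, ← Finset.sum_subset S.subset_univ
      (fun j _ hj => by simp [hw, hj]), ← Finset.sum_coe_sort]
    exact Finset.sum_congr rfl fun j _ => by simp [hw]
  have hw0 : w = 0 := by
    refine h t ht w fun i => ?_
    by_cases hi : i ∈ S
    · right
      have := hz ⟨i, hi⟩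
      rw [hmul]
      simpa [hw, hi, Matrix.mulVec, dotProduct] using this
    · left
      simp [hw, hi]
  funext i
  simpa [hw] using congrFun hw0 i

theorem SignType.mul_sign_sub_sign_nonneg {c p q x h u : ℝ} (hc : 0 < c) (hp : 0 ≤ p)
    (hq : 0 ≤ q) (hx : c * x = p * h - q * u) :
    0 ≤ x * ((SignType.sign h : ℝ) - (SignType.sign u : ℝ)) := by
  have key : ∀ a b : ℝ, 0 ≤ a * ((SignType.sign a : ℝ) - (SignType.sign b : ℝ)) := by
    intro a b
    rcases lt_trichotomy a 0 with ha | rfl | ha <;> rcases lt_trichotomy b 0 with hb | rfl | hb <;>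
      simp [*] <;> linarith
  have hcx : c * (x * ((SignType.sign h : ℝ) - (SignType.sign u : ℝ))) =
      p * (h * ((SignType.sign h : ℝ) - (SignType.sign u : ℝ))) +
      q * (u * ((SignType.sign u : ℝ) - (SignType.sign h : ℝ))) := by
    linear_combination ((SignType.sign h : ℝ) - (SignType.sign u : ℝ)) * hx
  refine nonneg_of_mul_nonneg_right ?_ hc
  rw [hcx]
  exact add_nonneg (mul_nonneg hp (key h u)) (mul_nonneg hq (key u h))

section MulVec

variable [DecidableEq V] [Fintype V] (Aset Astar : Finset (V × V)) (nu : V × V → ℝ) (s : V)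
  (z : LCPIdx Aset Astar → ℝ)

theorem lcpM_mulVec_source :
    (lcpM Aset Astar nu s).mulVec z (Sum.inl s) = z (Sum.inl s) := by
  simp [Matrix.mulVec, dotProduct, lcpM, Fintype.sum_sum_type]

theorem lcpM_mulVec_vertex {v : V} (hv : v ≠ s) :
    (lcpM Aset Astar nu s).mulVec z (Sum.inl v) =
      ∑ b : {a : V × V // a ∈ Aset}, ((if b.val.2 = v then (1 : ℝ) else 0) -
        (if b.val.1 = v then (1 : ℝ) else 0)) * z (Sum.inr (Sum.inl b)) := by
  simp [Matrix.mulVec, dotProduct, lcpM, Fintype.sum_sum_type, hv]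

theorem lcpM_mulVec_arc (a : {a : V × V // a ∈ Aset}) :
    (lcpM Aset Astar nu s).mulVec z (Sum.inr (Sum.inl a)) =
      -z (Sum.inl a.val.2) + (nu a.val)⁻¹ * z (Sum.inr (Sum.inl a)) +
        if h : a.val ∈ Aset \ Astar then z (Sum.inr (Sum.inr ⟨a.val, h⟩)) else 0 := by
  have hlast : ∑ b : {a : V × V // a ∈ Aset \ Astar},
      (if a.val = b.val then z (Sum.inr (Sum.inr b)) else 0) =
      if h : a.val ∈ Aset \ Astar then z (Sum.inr (Sum.inr ⟨a.val, h⟩)) else 0 := by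
    split_ifs with h
    · rw [Fintype.sum_eq_single ⟨a.val, h⟩ fun b hb => if_neg fun hab => hb (Subtype.ext hab.symm)]
      simp
    · exact Finset.sum_eq_zero fun b _ => if_neg fun hab : a.val = b.val => h (hab ▸ b.property)
  rw [← hlast]
  simp [Matrix.mulVec, dotProduct, lcpM, Fintype.sum_sum_type, add_assoc]

theorem lcpM_mulVec_nonresetting (a : {a : V × V // a ∈ Aset \ Astar}) :
    (lcpM Aset Astar nu s).mulVec z (Sum.inr (Sum.inr a)) =
      -z (Sum.inl a.val.1) +
        (nu a.val)⁻¹ * z (Sum.inr (Sum.inl ⟨a.val, (Finset.mem_sdiff.mp a.property).1⟩)) +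
        z (Sum.inr (Sum.inr a)) := by
  have hmid : ∑ b : {a : V × V // a ∈ Aset},
      (if a.val = b.val then (nu a.val)⁻¹ * z (Sum.inr (Sum.inl b)) else 0) =
      (nu a.val)⁻¹ * z (Sum.inr (Sum.inl ⟨a.val, (Finset.mem_sdiff.mp a.property).1⟩)) := by
    rw [Fintype.sum_eq_single ⟨a.val, (Finset.mem_sdiff.mp a.property).1⟩
      fun b hb => if_neg fun hab => hb (Subtype.ext hab.symm)]
    simp
  rw [← hmid]
  simp [Matrix.mulVec, dotProduct, lcpM, Fintype.sum_sum_type, add_assoc]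

end MulVec

theorem lcpM_eq_zero_of_complementary [DecidableEq V] [Fintype V]
    (Aset Astar : Finset (V × V)) (s : V) (nu : V × V → ℝ) (hnu : ∀ a ∈ Aset, 0 < nu a)
    {t : ℝ} (ht : 0 < t) (z : LCPIdx Aset Astar → ℝ)
    (hz : ∀ i, z i = 0 ∨ (lcpM Aset Astar nu s).mulVec z i + t * z i = 0) : z = 0 := by
  have hs : z (Sum.inl s) = 0 := by
    rcases hz (Sum.inl s) with h | h
    · exact h
    · rw [lcpM_mulVec_source] at h
      nlinarith
  have harc : ∀ a : {a : V × V // a ∈ Aset}, ∃ c p q : ℝ, 0 < c ∧ 0 ≤ p ∧ 0 ≤ q ∧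
      c * z (Sum.inr (Sum.inl a)) = p * z (Sum.inl a.val.2) - q * z (Sum.inl a.val.1) := by
    intro a
    have hnua : 0 < (nu a.val)⁻¹ := inv_pos.mpr (hnu a.val a.property)
    rcases hz (Sum.inr (Sum.inl a)) with h | h
    · exact ⟨1, 0, 0, one_pos, le_rfl, le_rfl, by simp [h]⟩
    rw [lcpM_mulVec_arc] at h
    split_ifs at h with ha
    · rcases hz (Sum.inr (Sum.inr ⟨a.val, ha⟩)) with h' | h'
      · exact ⟨(nu a.val)⁻¹ + t, 1, 0, by positivity, one_pos.le, le_rfl, by linarith⟩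
      · rw [lcpM_mulVec_nonresetting] at h'
        refine ⟨(nu a.val)⁻¹ * t + t + t * t, 1 + t, 1, by positivity, by positivity,
          one_pos.le, ?_⟩
        linear_combination (1 + t) * h - h'
    · exact ⟨(nu a.val)⁻¹ + t, 1, 0, by positivity, one_pos.le, le_rfl, by linarith⟩
  have hvertex : ∀ v : V, t * |z (Sum.inl v)| + ∑ b : {a : V × V // a ∈ Aset},
      (SignType.sign (z (Sum.inl v)) : ℝ) * (((if b.val.2 = v then (1 : ℝ) else 0) -
        (if b.val.1 = v then (1 : ℝ) else 0)) * z (Sum.inr (Sum.inl b))) = 0 := by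
    intro v
    rcases hz (Sum.inl v) with h | h
    · simp [h]
    · by_cases hv : v = s
      · subst hv
        simp [hs]
      · rw [lcpM_mulVec_vertex _ _ _ _ _ hv] at h
        rw [← Finset.mul_sum, ← sign_mul_self]
        linear_combination (SignType.sign (z (Sum.inl v)) : ℝ) * h
  have hswap : ∑ v : V, ∑ b : {a : V × V // a ∈ Aset},
      (SignType.sign (z (Sum.inl v)) : ℝ) * (((if b.val.2 = v then (1 : ℝ) else 0) -
        (if b.val.1 = v then (1 : ℝ) else 0)) * z (Sum.inr (Sum.inl b))) =
      ∑ b : {a : V × V // a ∈ Aset}, z (Sum.inr (Sum.inl b)) *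
        ((SignType.sign (z (Sum.inl b.val.2)) : ℝ) - SignType.sign (z (Sum.inl b.val.1))) := by
    rw [Finset.sum_comm]
    refine Finset.sum_congr rfl fun b _ => ?_
    simp only [← mul_assoc, ← Finset.sum_mul, mul_sub, Finset.sum_sub_distrib]
    simp [mul_comm, mul_sub]
  have hnonneg : 0 ≤ ∑ b : {a : V × V // a ∈ Aset}, z (Sum.inr (Sum.inl b)) *
      ((SignType.sign (z (Sum.inl b.val.2)) : ℝ) - SignType.sign (z (Sum.inl b.val.1))) := by
    refine Finset.sum_nonneg fun b _ => ?_
    obtain ⟨c, p, q, hc, hp, hq, h⟩ := harc b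
    exact SignType.mul_sign_sub_sign_nonneg hc hp hq h
  have htotal := Finset.sum_eq_zero fun v (_ : v ∈ (Finset.univ : Finset V)) => hvertex v
  rw [Finset.sum_add_distrib, hswap, ← Finset.mul_sum] at htotal
  have habs : ∑ v : V, |z (Sum.inl v)| = 0 := by
    refine le_antisymm ?_ (Finset.sum_nonneg fun v _ => abs_nonneg _)
    by_contra! hpos
    linarith [mul_pos ht hpos]
  have hl : ∀ v, z (Sum.inl v) = 0 := fun v => abs_eq_zero.mp
    ((Finset.sum_eq_zero_iff_of_nonneg fun v _ => abs_nonneg _).mp habs v (Finset.mem_univ v))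
  have hx : ∀ a, z (Sum.inr (Sum.inl a)) = 0 := by
    intro a
    obtain ⟨c, p, q, hc, -, -, h⟩ := harc a
    simpa [hl, hc.ne'] using h
  funext i
  rcases i with v | a | a
  · exact hl v
  · exact hx a
  · rcases hz (Sum.inr (Sum.inr a)) with h | h
    · exact h
    · rw [lcpM_mulVec_nonresetting, hl, hx] at h
      simp only [Pi.zero_apply]
      nlinarith

/-- All principal minors of the LCP matrix `M` are
non-negative. -/
theorem statement4 [DecidableEq V] [Fintype V]
    (Aset Astar : Finset (V × V)) (s t : V) (nu : V × V → ℝ)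
    (hG : IsSPGR Aset Astar s) (hnu : ∀ a ∈ Aset, 0 < nu a)
    (S : Finset (LCPIdx Aset Astar)) :
    0 ≤ Matrix.det ((lcpM Aset Astar nu s).submatrix
      (fun i : {i // i ∈ S} => i.val) (fun j : {j // j ∈ S} => j.val)) := by
  exact Matrix.det_principal_submatrix_nonneg _
    (fun _ ht z hz => lcpM_eq_zero_of_complementary Aset Astar s nu hnu ht z hz) S
end
end

section
/- All principal minors of the weighted Laplacian matrix of a directed graph with positive arc weights are non-negative: for every subset U ⊆ V, det(L_{U,U}) ≥ 0. -/
noncomputable section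

open Finset

variable {V : Type*}

/-- The incidence matrix `B` of the directed graph `(V, Aset)`. -/
def incB [DecidableEq V] (Aset : Finset (V × V)) : Matrix V {a : V × V // a ∈ Aset} ℝ :=
  fun v a => (if a.val.2 = v then (1 : ℝ) else 0) - (if a.val.1 = v then (1 : ℝ) else 0)

/-- The positive part `B⁺` of the incidence matrix. -/
def incBplus [DecidableEq V] (Aset : Finset (V × V)) : Matrix V {a : V × V // a ∈ Aset} ℝ :=
  fun v a => if a.val.2 = v then (1 : ℝ) else 0

/-- The weighted (directed) Laplacian matrix of `(V, Aset)` with weights `nu`. -/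
def lapL [DecidableEq V] (Aset : Finset (V × V)) (nu : V × V → ℝ) : Matrix V V ℝ :=
  fun v w =>
    if v = w then ∑ a ∈ Aset.filter (fun a => a.2 = v), nu a
    else if (v, w) ∈ Aset then -nu (v, w) else 0

/-- A real matrix that is weakly column diagonally dominant with nonnegative diagonal has
nonnegative determinant. -/
theorem det_nonneg_of_sum_col_le_diag {n : Type*} [Fintype n] [DecidableEq n]
    (M : Matrix n n ℝ) (h : ∀ k, ∑ i ∈ univ.erase k, |M i k| ≤ M k k) : 0 ≤ M.det := by
  by_contra! hneg
  let g : ℝ → ℝ := fun s => (s • M + (1 - s) • (1 : Matrix n n ℝ)).det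
  have hg : Continuous g := by
    unfold g
    fun_prop
  have h0 : g 0 = 1 := by simp [g]
  have h1 : g 1 = M.det := by simp [g]
  obtain ⟨s, hs, hs0⟩ := intermediate_value_Icc' zero_le_one hg.continuousOn
    (show (0 : ℝ) ∈ Set.Icc (g 1) (g 0) by rw [h0, h1]; exact ⟨hneg.le, zero_le_one⟩)
  have hs1 : s < 1 := by
    refine lt_of_le_of_ne hs.2 ?_
    rintro rfl
    linarith
  refine det_ne_zero_of_sum_col_lt_diag (fun k => ?_) hs0
  calc ∑ i ∈ univ.erase k, ‖(s • M + (1 - s) • (1 : Matrix n n ℝ)) i k‖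
      = s * ∑ i ∈ univ.erase k, |M i k| := by
        rw [mul_sum]
        refine sum_congr rfl fun i hi => ?_
        simp [Matrix.one_apply_ne (ne_of_mem_erase hi), abs_of_nonneg hs.1]
    _ ≤ s * M k k := mul_le_mul_of_nonneg_left (h k) hs.1
    _ < s * M k k + (1 - s) := by linarith
    _ ≤ ‖(s • M + (1 - s) • (1 : Matrix n n ℝ)) k k‖ := by
        simpa using le_abs_self (s * M k k + (1 - s))

/-- All principal minors of the weighted Laplacian matrix of a
directed graph with positive arc weights are non-negative. -/
theorem statement6 [DecidableEq V] [Fintype V]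
    (Aset : Finset (V × V)) (nu : V × V → ℝ) (hnu : ∀ a ∈ Aset, 0 < nu a)
    (U : Finset V) :
    0 ≤ Matrix.det ((lapL Aset nu).submatrix
      (fun i : {v // v ∈ U} => i.val) (fun j : {v // v ∈ U} => j.val)) := by
  refine det_nonneg_of_sum_col_le_diag _ fun k => ?_
  let e : {v // v ∈ U} ↪ V × V := ⟨fun i => (i.val, k.val), fun i j hij =>
    Subtype.ext (congrArg Prod.fst hij)⟩
  calc ∑ i ∈ univ.erase k, |lapL Aset nu i.val k.val|
      = ∑ i ∈ (univ.erase k).filter (fun i => (i.val, k.val) ∈ Aset), nu (i.val, k.val) := by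
        rw [sum_filter]
        refine sum_congr rfl fun i hi => ?_
        have hik : i.val ≠ k.val := fun hik => ne_of_mem_erase hi (Subtype.ext hik)
        by_cases hA : (i.val, k.val) ∈ Aset
        · simp [lapL, hik, hA, abs_of_pos (hnu _ hA)]
        · simp [lapL, hik, hA]
    _ = ∑ a ∈ ((univ.erase k).filter (fun i => (i.val, k.val) ∈ Aset)).map e, nu a :=
        (sum_map _ e nu).symm
    _ ≤ ∑ a ∈ Aset.filter (fun a => a.2 = k.val), nu a := by
        refine sum_le_sum_of_subset_of_nonneg ?_ fun a ha _ => (hnu a (mem_filter.mp ha).1).le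
        intro a ha
        obtain ⟨i, hi, rfl⟩ := mem_map.mp ha
        exact mem_filter.mpr ⟨(mem_filter.mp hi).2, rfl⟩
    _ = lapL Aset nu k.val k.val := by simp [lapL]
end
end

section
/- Let G' = (V, A', A*) be a shortest path graph with resetting with positive capacities ν. Let x' and x̂' be two normalized thin s–t flows with resetting in G' with corresponding labels ℓ' and ℓ̂', respectively. If the flow values satisfy |x'| ≤ |x̂'| and the labels satisfy ℓ'_s ≤ ℓ̂'_s, then ℓ'_v ≤ ℓ̂'_v for every v ∈ V. -/
noncomputable section

open Finset

variable {V : Type*}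

theorem sum_mul_inSum [DecidableEq V] [Fintype V] (Aset : Finset (V × V)) (x : V × V → ℝ)
    (f : V → ℝ) : ∑ v, f v * inSum Aset x v = ∑ a ∈ Aset, f a.2 * x a := by
  rw [← Finset.sum_fiberwise Aset (fun a => a.2) (fun a => f a.2 * x a)]
  refine Finset.sum_congr rfl fun v _ => ?_
  rw [inSum, Finset.mul_sum]
  refine Finset.sum_congr rfl fun a ha => ?_
  rw [(Finset.mem_filter.mp ha).2]

theorem sum_mul_outSum [DecidableEq V] [Fintype V] (Aset : Finset (V × V)) (x : V × V → ℝ)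
    (f : V → ℝ) : ∑ v, f v * outSum Aset x v = ∑ a ∈ Aset, f a.1 * x a := by
  rw [← Finset.sum_fiberwise Aset (fun a => a.1) (fun a => f a.1 * x a)]
  refine Finset.sum_congr rfl fun v _ => ?_
  rw [outSum, Finset.mul_sum]
  refine Finset.sum_congr rfl fun a ha => ?_
  rw [(Finset.mem_filter.mp ha).2]

/-- A potential vanishing at the sink, differentiated along a flow, only sees the source. -/
theorem IsFlowOn.sum_potential [DecidableEq V] [Fintype V] {Aset : Finset (V × V)} {s t : V}
    {x : V × V → ℝ} {val : ℝ} (h : IsFlowOn Finset.univ Aset s t x val)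
    (f : V → ℝ) (hf : f t = 0) :
    ∑ a ∈ Aset, (f a.2 - f a.1) * x a = -(f s * val) := by
  obtain ⟨-, hcons, hval⟩ := h
  simp only [sub_mul, Finset.sum_sub_distrib]
  rw [← sum_mul_inSum Aset x f, ← sum_mul_outSum Aset x f, ← Finset.sum_sub_distrib,
    Finset.sum_eq_single s]
  · rw [← hval]; ring
  · intro v _ hv
    by_cases hvt : v = t
    · simp [hvt, hf]
    · rw [hcons v (Finset.mem_univ v) hv hvt, sub_self]
  · simp

/-- With positive capacity, `arcRho` reflects strict inequalities to the flow when the label at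
the tail does not increase. -/
theorem lt_of_arcRho_lt [DecidableEq V] {Astar : Finset (V × V)} {nu : V × V → ℝ} {a : V × V}
    (hnu : 0 < nu a) {p q y z : ℝ} (hpq : p ≤ q)
    (h : arcRho Astar nu a q z < arcRho Astar nu a p y) : z < y := by
  by_contra! hyz
  have hdiv : y / nu a ≤ z / nu a := by gcongr
  refine h.not_ge ?_
  unfold arcRho
  split_ifs
  · exact hdiv
  · exact max_le_max hpq hdiv

/-- With positive capacity, `arcRho` reflects inequalities to the flow when the label at the tail
strictly decreases. -/
theorem le_of_arcRho_le [DecidableEq V] {Astar : Finset (V × V)} {nu : V × V → ℝ} {a : V × V}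
    (hnu : 0 < nu a) {p q y z : ℝ} (hqp : q < p)
    (h : arcRho Astar nu a p y ≤ arcRho Astar nu a q z) : y ≤ z := by
  refine (div_le_div_iff_of_pos_right hnu).mp ?_
  unfold arcRho at h
  split_ifs at h
  · exact h
  · rcases le_max_iff.mp ((le_max_left p _).trans h) with hp | hp
    · exact absurd hp hqp.not_ge
    · rw [max_eq_right (hqp.le.trans hp)] at h
      exact (le_max_right _ _).trans h

/-- In a finite acyclic digraph, every vertex set with an element has an element all of whose
predecessors lie outside the set. -/
theorem exists_source_of_acyclic [Finite V] {r : V → V → Prop}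
    (hr : ∀ v, ¬ Relation.TransGen r v v) {S : Set V} (hS : S.Nonempty) :
    ∃ w ∈ S, ∀ v, r v w → v ∉ S := by
  have : Std.Irrefl (Relation.TransGen r) := ⟨hr⟩
  have hwf : WellFounded (Relation.TransGen r) := Finite.wellFounded_of_trans_of_irrefl _
  obtain ⟨w, hw, hmin⟩ := hwf.has_min S hS
  exact ⟨w, hw, fun v hv hvS => hmin v hvS (.single hv)⟩

/-- Monotonicity of labels: if `|x'| ≤ |x̂'|` and
`ℓ'_s ≤ ℓ̂'_s`, then `ℓ' ≤ ℓ̂'` element-wise. -/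
theorem statement9 [DecidableEq V] [Fintype V]
    (Aset Astar : Finset (V × V)) (s t : V) (nu : V × V → ℝ)
    (hG : IsSPGR Aset Astar s) (hnu : ∀ a ∈ Aset, 0 < nu a)
    (x xh : V × V → ℝ) (val valh : ℝ) (l lh : V → ℝ)
    (h1 : IsNTF Aset Astar nu s t x val l)
    (h2 : IsNTF Aset Astar nu s t xh valh lh)
    (hval : val ≤ valh) (hs : l s ≤ lh s) :
    ∀ v : V, l v ≤ lh v := by
  obtain ⟨-, hacyc, hreach⟩ := hG
  obtain ⟨hflow, -, hmin, htight⟩ := h1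
  obtain ⟨hflowh, -, hminh, htighth⟩ := h2
  by_contra! hne
  have hws : ∀ {w}, lh w < l w → w ≠ s := by
    rintro w hw rfl
    exact hw.not_ge hs
  have hns : ∀ a ∈ Aset, a.2 ≠ s := fun a ha has =>
    hacyc s (.tail' (hreach a.1) (show (a.1, s) ∈ Aset from has ▸ ha))
  have hle : ∀ a ∈ Aset, lh a.2 < l a.2 → l a.2 ≤ arcRho Astar nu a (l a.1) (x a) :=
    fun a ha hw => (hmin a.2 (Finset.mem_univ _) (hws hw)).1 a ha rfl
  have hent : ∀ a ∈ Aset, l a.1 ≤ lh a.1 → lh a.2 < l a.2 →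
      lh a.2 = arcRho Astar nu a (lh a.1) (xh a) → xh a < x a := by
    intro a ha hv hw heq
    exact lt_of_arcRho_lt (hnu a ha) hv (heq ▸ hw.trans_le (hle a ha hw))
  have hent' : ∀ a ∈ Aset, l a.1 ≤ lh a.1 → lh a.2 < l a.2 → xh a ≤ x a := by
    intro a ha hv hw
    rcases (hflowh.1 a ha).lt_or_eq with hpos | hzero
    · exact (hent a ha hv hw (htighth a ha hpos)).le
    · exact hzero ▸ hflow.1 a ha
  have hleave : ∀ a ∈ Aset, lh a.1 < l a.1 → l a.2 ≤ lh a.2 → x a ≤ xh a := by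
    intro a ha hv hw
    rcases (hflow.1 a ha).lt_or_eq with hpos | hzero
    · refine le_of_arcRho_le (Astar := Astar) (hnu a ha) hv ?_
      rw [← htight a ha hpos]
      exact hw.trans ((hminh a.2 (Finset.mem_univ _) (hns a ha)).1 a ha rfl)
    · exact hzero ▸ hflowh.1 a ha
  let f : V → ℝ := fun v => (if lh v < l v then 1 else 0) - (if lh t < l t then 1 else 0)
  have hft : f t = 0 := sub_self _
  have hfs : f s ≤ 0 := by
    simp only [f, if_neg hs.not_gt]
    split_ifs <;> norm_num
  have hnonneg : ∀ a ∈ Aset, 0 ≤ (f a.2 - f a.1) * (x a - xh a) := by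
    intro a ha
    simp only [f, sub_sub_sub_cancel_right]
    split_ifs with hw hv hv
    · simp
    · linarith [hent' a ha (not_lt.mp hv) hw]
    · linarith [hleave a ha hv (not_lt.mp hw)]
    · simp
  have hsum : ∑ a ∈ Aset, (f a.2 - f a.1) * (x a - xh a) ≤ 0 := by
    simp only [mul_sub, Finset.sum_sub_distrib, hflow.sum_potential f hft,
      hflowh.sum_potential f hft]
    nlinarith [mul_le_mul_of_nonpos_left hval hfs]
  have hzero := (Finset.sum_eq_zero_iff_of_nonneg hnonneg).mp
    (hsum.antisymm (Finset.sum_nonneg hnonneg))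
  obtain ⟨w, hw, hpred⟩ := exists_source_of_acyclic hacyc (S := {v | lh v < l v}) hne
  obtain ⟨a, ha, rfl, hlha⟩ := (hminh w (Finset.mem_univ _) (hws hw)).2
  have hv : ¬ lh a.1 < l a.1 := hpred a.1 ha
  have hlt := hent a ha (not_lt.mp hv) hw hlha
  have h0 := hzero a ha
  simp only [f, if_pos (show lh a.2 < l a.2 from hw), if_neg hv] at h0
  linarith
end
end

section
/- Let G' = (V, A', A*) be a shortest path graph with resetting with positive capacities ν. If x' and x̂' are normalized thin s–t flows with resetting in G' with corresponding labels ℓ' and ℓ̂' such that the flow values satisfy |x'| = |x̂'| and ℓ'_s = ℓ̂'_s, then ℓ' = ℓ̂'. That is, the corresponding labels are uniquely determined by the flow value and the label at s. -/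
noncomputable section

open Finset

variable {V : Type*}

/-- The net inflow into a vertex set is the total flow on arcs with head in the set minus the
total flow on arcs with tail in the set. -/
theorem sum_inSum_sub_outSum [DecidableEq V] (Aset : Finset (V × V)) (x : V × V → ℝ)
    (S : Finset V) :
    ∑ v ∈ S, (inSum Aset x v - outSum Aset x v) =
      ∑ a ∈ Aset, ((if a.2 ∈ S then x a else 0) - (if a.1 ∈ S then x a else 0)) := by
  simp only [Finset.sum_sub_distrib, inSum, outSum, Finset.sum_fiberwise_eq_sum_filter]
  simp only [Finset.sum_filter]

/-- Two static `s`-`t` flows of the same value have the same net inflow at every vertex. -/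
theorem IsFlowOn.inSum_sub_outSum_eq [DecidableEq V] [Fintype V] {Aset : Finset (V × V)}
    {s t : V} {x xh : V × V → ℝ} {val : ℝ} (h1 : IsFlowOn Finset.univ Aset s t x val)
    (h2 : IsFlowOn Finset.univ Aset s t xh val) (v : V) :
    inSum Aset x v - outSum Aset x v = inSum Aset xh v - outSum Aset xh v := by
  have hne : ∀ u, u ≠ t →
      inSum Aset x u - outSum Aset x u = inSum Aset xh u - outSum Aset xh u := by
    intro u hut
    by_cases hus : u = s
    · subst hus
      linarith [h1.2.2, h2.2.2]
    · linarith [h1.2.1 u (mem_univ u) hus hut, h2.2.1 u (mem_univ u) hus hut]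
  by_cases hvt : v = t
  · subst hvt
    have e1 := sum_inSum_sub_outSum Aset x univ
    have e2 := sum_inSum_sub_outSum Aset xh univ
    simp only [mem_univ, if_true, sub_self, sum_const_zero] at e1 e2
    rw [← Finset.add_sum_erase _ _ (mem_univ v)] at e1 e2
    have e3 := Finset.sum_congr (rfl : univ.erase v = univ.erase v)
      (fun u hu => hne u (Finset.ne_of_mem_erase hu))
    linarith
  · exact hne v hvt

/-- No arc of a shortest path graph with resetting enters the source. -/
theorem IsSPGR.head_ne_source [DecidableEq V] {Aset Astar : Finset (V × V)} {s : V} {a : V × V}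
    (hG : IsSPGR Aset Astar s) (ha : a ∈ Aset) : a.2 ≠ s := by
  rintro rfl
  exact hG.2.1 a.2 (Relation.TransGen.tail' (hG.2.2 a.1) ha)

section Comparison

variable [DecidableEq V] [Fintype V] {Aset Astar : Finset (V × V)} {s t : V} {nu : V × V → ℝ}
  {x xh : V × V → ℝ} {val valh : ℝ} {l lh : V → ℝ} {a : V × V}

/-- An arc along which the first labelling becomes larger than the second one carries
at least as much flow in the first thin flow. -/
theorem IsNTF.le_of_entering (hnu : ∀ a ∈ Aset, 0 < nu a)
    (h1 : IsNTF Aset Astar nu s t x val l) (h2 : IsNTF Aset Astar nu s t xh valh lh)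
    (ha : a ∈ Aset) (hs : a.2 ≠ s) (htail : l a.1 ≤ lh a.1) (hhead : lh a.2 < l a.2) :
    xh a ≤ x a := by
  rcases (h2.1.1 a ha).eq_or_lt with h0 | hpos
  · rw [← h0]
    exact h1.1.1 a ha
  · have hle := (h1.2.2.1 a.2 (mem_univ _) hs).1 a ha rfl
    have heq := h2.2.2.2 a ha hpos
    rw [← div_le_div_iff_of_pos_right (hnu a ha)]
    unfold arcRho at hle heq
    split_ifs at hle heq
    · linarith
    · rcases le_max_iff.1 hle with h | h
      · linarith [le_max_left (lh a.1) (xh a / nu a)]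
      · linarith [le_max_right (lh a.1) (xh a / nu a)]

/-- An arc along which the first labelling stops being larger than the second one carries
at most as much flow in the first thin flow. -/
theorem IsNTF.le_of_leaving (hnu : ∀ a ∈ Aset, 0 < nu a)
    (h1 : IsNTF Aset Astar nu s t x val l) (h2 : IsNTF Aset Astar nu s t xh valh lh)
    (ha : a ∈ Aset) (hs : a.2 ≠ s) (htail : lh a.1 < l a.1) (hhead : l a.2 ≤ lh a.2) :
    x a ≤ xh a := by
  rcases (h1.1.1 a ha).eq_or_lt with h0 | hpos
  · rw [← h0]
    exact h2.1.1 a ha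
  · have heq := h1.2.2.2 a ha hpos
    have hle := (h2.2.2.1 a.2 (mem_univ _) hs).1 a ha rfl
    rw [← div_le_div_iff_of_pos_right (hnu a ha)]
    unfold arcRho at hle heq
    split_ifs at hle heq
    · linarith
    · rcases le_max_iff.1 hle with h | h
      · linarith [le_max_left (l a.1) (x a / nu a)]
      · linarith [le_max_right (l a.1) (x a / nu a)]

/-- A nonempty set of vertices of a shortest path graph with resetting has a member none of
whose predecessors lie in the set. -/
theorem IsSPGR.exists_no_predecessor (hG : IsSPGR Aset Astar s) {S : Set V}
    (hS : S.Nonempty) : ∃ w ∈ S, ∀ a ∈ Aset, a.2 = w → a.1 ∉ S := by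
  let r := Relation.TransGen (fun u w => (u, w) ∈ Aset)
  have : Std.Irrefl r := ⟨hG.2.1⟩
  have : IsTrans V r := ⟨fun _ _ _ => Relation.TransGen.trans⟩
  obtain ⟨w, hw, hmin⟩ := (Finite.wellFounded_of_trans_of_irrefl r).has_min S hS
  refine ⟨w, hw, ?_⟩
  rintro a ha rfl ha1
  exact hmin a.1 ha1 (Relation.TransGen.single ha)

/-- Thin flows with the same value carry the same flow on every
arc entering the set where the first labelling exceeds the second one. -/
theorem IsNTF.eq_of_entering (hG : IsSPGR Aset Astar s) (hnu : ∀ a ∈ Aset, 0 < nu a)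
    (h1 : IsNTF Aset Astar nu s t x val l) (h2 : IsNTF Aset Astar nu s t xh val lh)
    (ha : a ∈ Aset) (htail : l a.1 ≤ lh a.1) (hhead : lh a.2 < l a.2) : x a = xh a := by
  let S : Finset V := {v | lh v < l v}
  have hS : ∀ v, v ∈ S ↔ lh v < l v := by simp [S]
  have hnet := Finset.sum_congr (rfl : S = S) fun v _ => h1.1.inSum_sub_outSum_eq h2.1 v
  rw [sum_inSum_sub_outSum, sum_inSum_sub_outSum, ← sub_eq_zero, ← Finset.sum_sub_distrib,
    Finset.sum_eq_zero_iff_of_nonneg] at hnet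
  · have := hnet a ha
    simp only [hS, hhead, htail.not_gt, if_true, if_false] at this
    linarith
  · intro b hb
    have hbs := hG.head_ne_source hb
    simp only [hS]
    split_ifs with hb2 hb1 hb1
    · linarith
    · linarith [h1.le_of_entering hnu h2 hb hbs (not_lt.1 hb1) hb2]
    · linarith [h1.le_of_leaving hnu h2 hb hbs hb1 (not_lt.1 hb2)]
    · linarith

/-- The labels of a thin flow are bounded by those of any other thin flow with the same value
and the same label at the source. -/
theorem IsNTF.label_le (hG : IsSPGR Aset Astar s) (hnu : ∀ a ∈ Aset, 0 < nu a)
    (h1 : IsNTF Aset Astar nu s t x val l) (h2 : IsNTF Aset Astar nu s t xh val lh)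
    (hs : l s = lh s) (v : V) : l v ≤ lh v := by
  by_contra! hv
  obtain ⟨w, hw, hpred⟩ := hG.exists_no_predecessor (S := {u | lh u < l u}) ⟨v, hv⟩
  have hws : w ≠ s := by
    rintro rfl
    exact hw.ne' hs
  obtain ⟨a, ha, rfl, hrho⟩ := (h2.2.2.1 w (mem_univ _) hws).2
  have htail : l a.1 ≤ lh a.1 := not_lt.1 (hpred a ha rfl)
  have hx := h1.eq_of_entering hG hnu h2 ha htail hw
  have hle := (h1.2.2.1 a.2 (mem_univ _) hws).1 a ha rfl
  have hmono : arcRho Astar nu a (l a.1) (x a) ≤ arcRho Astar nu a (lh a.1) (xh a) := by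
    rw [hx]
    unfold arcRho
    split_ifs
    · rfl
    · exact max_le_max htail le_rfl
  exact (hle.trans (hmono.trans hrho.ge)).not_gt hw

end Comparison

/-- Uniqueness of labels: the corresponding labels of a
normalized thin flow with resetting are determined by the flow value and the
label at `s`. -/
theorem statement10 [DecidableEq V] [Fintype V]
    (Aset Astar : Finset (V × V)) (s t : V) (nu : V × V → ℝ)
    (hG : IsSPGR Aset Astar s) (hnu : ∀ a ∈ Aset, 0 < nu a)
    (x xh : V × V → ℝ) (val : ℝ) (l lh : V → ℝ)
    (h1 : IsNTF Aset Astar nu s t x val l)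
    (h2 : IsNTF Aset Astar nu s t xh val lh)
    (hs : l s = lh s) :
    l = lh := by
  exact funext fun v => le_antisymm (h1.label_le hG hnu h2 hs v) (h2.label_le hG hnu h1 hs.symm v)
end
end

section
/- Let G' = (V, A', A*) be a shortest path graph with resetting with positive capacities ν, and let x' be a normalized thin s–t flow with resetting in G' with corresponding labels ℓ'. Then for every arc a = (v,w) ∈ A': if a ∈ A*, or a ∈ A'∖A* and ℓ'_v < ℓ'_w, then x'_a = ν_a · ℓ'_w; and if a ∈ A'∖A* and ℓ'_v > ℓ'_w, then x'_a = 0. In particular, the flow values on all arcs whose endpoint labels differ are uniquely determined by the labels. -/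
noncomputable section

open Finset

variable {V : Type*}

/-- The flow on arcs whose endpoint labels differ (and on
resetting arcs) is determined by the labels. -/
theorem statement14 [DecidableEq V] [Fintype V]
    (Aset Astar : Finset (V × V)) (s t : V) (nu : V × V → ℝ)
    (hG : IsSPGR Aset Astar s) (hnu : ∀ a ∈ Aset, 0 < nu a)
    (x : V × V → ℝ) (val : ℝ) (l : V → ℝ)
    (h : IsNTF Aset Astar nu s t x val l) :
    ∀ a ∈ Aset,
      ((a ∈ Astar ∨ (a ∉ Astar ∧ l a.1 < l a.2)) → x a = nu a * l a.2) ∧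
      ((a ∉ Astar ∧ l a.2 < l a.1) → x a = 0) := by
  obtain ⟨-, hacyc, hreach⟩ := hG
  obtain ⟨⟨hx, -, -⟩, hl, hlabel, hpos⟩ := h
  rintro ⟨v, w⟩ ha
  have hws : w ≠ s := by
    rintro rfl
    exact hacyc w (Relation.TransGen.tail' (hreach v) ha)
  have hν := hnu _ ha
  have hlv := hl v (mem_univ v)
  have hlw := hl w (mem_univ w)
  have hle := (hlabel w (mem_univ w) hws).1 _ ha rfl
  have heq := hpos _ ha
  have hx0 := hx _ ha
  simp only [arcRho] at hle heq ⊢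
  refine ⟨?_, ?_⟩
  · rintro (hs | ⟨hs, hlt⟩)
    · rw [if_pos hs] at hle heq
      rcases hx0.eq_or_lt with h0 | h0
      · rw [← h0, zero_div] at hle
        rw [← h0, le_antisymm hle hlw, mul_zero]
      · rw [heq h0, mul_div_cancel₀ _ hν.ne']
    · rw [if_neg hs] at hle heq
      have hdiv : l w ≤ x (v, w) / nu (v, w) := (le_max_iff.1 hle).resolve_left hlt.not_ge
      have h0 : 0 < x (v, w) := (div_pos_iff_of_pos_right hν).1 ((hlv.trans_lt hlt).trans_le hdiv)
      rw [hdiv.antisymm ((le_max_right _ _).trans_eq (heq h0).symm), mul_div_cancel₀ _ hν.ne']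
  · rintro ⟨hs, hlt⟩
    rw [if_neg hs] at heq
    by_contra hne
    exact hlt.not_ge ((le_max_left _ _).trans_eq (heq (hx0.lt_of_ne' hne)).symm)
end
end

section
/- Let g : ℝ → ℝ be a locally integrable right-monotone function, and let G : ℝ → ℝ be defined by G(ξ) = ∫₀^ξ g(ξ̂) dξ̂. If the infimum of the set {ξ > 0 : G(ξ) > 0} equals 0, then there exists ε > 0 such that g > 0 almost everywhere on (0, ε) and G > 0 everywhere on (0, ε). -/
noncomputable section

open Finset

open MeasureTheory

/-- `g` is monotone (non-decreasing or non-increasing) on `S` up to a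
set of measure zero. -/
def AEMonotoneOn (g : ℝ → ℝ) (S : Set ℝ) : Prop :=
  ∃ N : Set ℝ, volume N = 0 ∧
    ((∀ x ∈ S \ N, ∀ y ∈ S \ N, x ≤ y → g x ≤ g y) ∨
     (∀ x ∈ S \ N, ∀ y ∈ S \ N, x ≤ y → g y ≤ g x))

/-- `g` is right-monotone: every point is the lower end point of a closed
interval on which `g` is monotone. -/
def RightMonotone (g : ℝ → ℝ) : Prop :=
  ∀ xi : ℝ, ∃ eps > (0 : ℝ), AEMonotoneOn g (Set.Icc xi (xi + eps))

/-- `g` is left-monotone: every point is the upper end point of a closed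
interval on which `g` is monotone. -/
def LeftMonotone (g : ℝ → ℝ) : Prop :=
  ∀ xi : ℝ, ∃ eps > (0 : ℝ), AEMonotoneOn g (Set.Icc (xi - eps) xi)

/-- A function with positive integral over `(0, ξ)` takes a positive value there, outside any
given null set. -/
theorem exists_pos_of_intervalIntegral_pos {g : ℝ → ℝ} {N : Set ℝ} (hN : volume N = 0) {ξ : ℝ}
    (hξ : 0 < ξ) (h : 0 < ∫ θ in (0 : ℝ)..ξ, g θ) :
    ∃ y, 0 < y ∧ y ≤ ξ ∧ y ∉ N ∧ 0 < g y := by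
  by_contra! hcon
  refine h.not_ge ?_
  rw [intervalIntegral.integral_of_le hξ.le]
  apply integral_nonpos_of_ae
  filter_upwards [ae_restrict_mem measurableSet_Ioc,
    ae_restrict_of_ae (measure_eq_zero_iff_ae_notMem.mp hN)] with y hy hyN
  exact hcon y hy.1 hy.2 hyN

/-- The integral over `(0, ξ)` of a locally integrable function that is positive almost everywhere
there is positive. -/
theorem intervalIntegral_pos_of_ae_pos {g : ℝ → ℝ} (hg : LocallyIntegrable g volume) {ξ : ℝ}
    (hξ : 0 < ξ) (hpos : ∀ᵐ x ∂volume, x ∈ Set.Ioc 0 ξ → 0 < g x) :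
    0 < ∫ θ in (0 : ℝ)..ξ, g θ := by
  have hint : IntegrableOn g (Set.Ioc 0 ξ) :=
    (hg.integrableOn_isCompact isCompact_Icc).mono_set Set.Ioc_subset_Icc_self
  have hpos' : ∀ᵐ x ∂volume.restrict (Set.Ioc 0 ξ), 0 < g x :=
    (ae_restrict_iff' measurableSet_Ioc).mpr hpos
  rw [intervalIntegral.integral_of_le hξ.le,
    integral_pos_iff_support_of_nonneg_ae (hpos'.mono fun _ hx => hx.le) hint]
  have hsupp : Function.support g =ᵐ[volume.restrict (Set.Ioc 0 ξ)] Set.univ :=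
    Filter.eventuallyEq_univ.mpr (hpos'.mono fun _ hx => hx.ne')
  rw [measure_congr hsupp]
  simpa using hξ

/-- If `G(ξ) = ∫₀^ξ g` and `inf {ξ > 0 : G(ξ) > 0} = 0`, then
`g > 0` a.e. and `G > 0` on some interval `(0, ε)`. -/
theorem statement16 (g : ℝ → ℝ)
    (hg : LocallyIntegrable g volume)
    (hgrm : RightMonotone g)
    (hinf : ∀ eps > (0 : ℝ), ∃ xi : ℝ, 0 < xi ∧ xi < eps ∧
      0 < ∫ th in (0 : ℝ)..xi, g th) :
    ∃ eps > (0 : ℝ),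
      (∀ᵐ xi ∂volume, xi ∈ Set.Ioo (0 : ℝ) eps → 0 < g xi) ∧
      ∀ xi ∈ Set.Ioo (0 : ℝ) eps, 0 < ∫ th in (0 : ℝ)..xi, g th := by
  obtain ⟨δ, hδ, N, hN, hmono⟩ := hgrm 0
  rw [zero_add] at hmono
  have hex : ∀ η > (0 : ℝ), ∃ y, 0 < y ∧ y < η ∧ y ∉ N ∧ 0 < g y := fun η hη => by
    obtain ⟨ξ, hξ, hξη, hG⟩ := hinf η hη
    obtain ⟨y, hy, hyξ, hyN, hgy⟩ := exists_pos_of_intervalIntegral_pos hN hξ hG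
    exact ⟨y, hy, hyξ.trans_lt hξη, hyN, hgy⟩
  have hpos : ∃ ε > (0 : ℝ), ∀ x ∈ Set.Ioo 0 ε, x ∉ N → 0 < g x := by
    rcases hmono with hmono | hmono
    · refine ⟨δ, hδ, fun x hx hxN => ?_⟩
      obtain ⟨y, hy, hyx, hyN, hgy⟩ := hex x hx.1
      exact hgy.trans_le
        (hmono y ⟨⟨hy.le, (hyx.trans hx.2).le⟩, hyN⟩ x ⟨⟨hx.1.le, hx.2.le⟩, hxN⟩ hyx.le)
    · obtain ⟨y, hy, hyδ, hyN, hgy⟩ := hex δ hδ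
      refine ⟨y, hy, fun x hx hxN => ?_⟩
      exact hgy.trans_le
        (hmono x ⟨⟨hx.1.le, (hx.2.trans hyδ).le⟩, hxN⟩ y ⟨⟨hy.le, hyδ.le⟩, hyN⟩ hx.2.le)
  obtain ⟨ε, hε, hpos⟩ := hpos
  have hae : ∀ᵐ x ∂volume, x ∈ Set.Ioo (0 : ℝ) ε → 0 < g x := by
    filter_upwards [measure_eq_zero_iff_ae_notMem.mp hN] with x hxN hx using hpos x hx hxN
  exact ⟨ε, hε, hae, fun ξ hξ => intervalIntegral_pos_of_ae_pos hg hξ.1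
    (hae.mono fun x hx hxξ => hx ⟨hxξ.1, hxξ.2.trans_lt hξ.2⟩)⟩
end
end
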